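/- arXiv:1912.07566 — 2 statements merged into one kernel-verified Lean document; each statement's English description precedes it below -/
import Mathlib

section
/- For every real D ≥ 2000, sliding does not occur for D. -/
/-- Difference of two lattice points. -/
def sub2 (P Q : ℤ × ℤ) : ℤ × ℤ := (P.1 - Q.1, P.2 - Q.2)

/-- Determinant of two lattice vectors. -/
def det2 (u v : ℤ × ℤ) : ℤ := u.1 * v.2 - u.2 * v.1

/-- Dot product of two lattice vectors. -/
def dot2 (u v : ℤ × ℤ) : ℤ := u.1 * v.1 + u.2 * v.2

/-- Squared Euclidean norm of a lattice vector. -/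
def normSq2 (u : ℤ × ℤ) : ℤ := u.1 ^ 2 + u.2 ^ 2

/-- Membership in `𝒯(D)`: a non-degenerate lattice triangle with all three side
lengths at least `D` and all three angles at most `π/2` (for a non-degenerate
triangle, the angle at a vertex is at most `π/2` iff the dot product of the two
edge vectors emanating from that vertex is nonnegative). -/
def InT (D : ℝ) (P Q R : ℤ × ℤ) : Prop :=
  det2 (sub2 Q P) (sub2 R P) ≠ 0 ∧
  D ≤ Real.sqrt (normSq2 (sub2 Q P)) ∧
  D ≤ Real.sqrt (normSq2 (sub2 R Q)) ∧
  D ≤ Real.sqrt (normSq2 (sub2 P R)) ∧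
  0 ≤ dot2 (sub2 Q P) (sub2 R P) ∧
  0 ≤ dot2 (sub2 P Q) (sub2 R Q) ∧
  0 ≤ dot2 (sub2 P R) (sub2 Q R)

/-- Twice the area of a lattice triangle, `|det (Q - P, R - P)|`, a natural number. -/
def twiceArea (P Q R : ℤ × ℤ) : ℕ := (det2 (sub2 Q P) (sub2 R P)).natAbs

/-- `S D` is twice the minimal area of a triangle in `𝒯(D)`. -/
noncomputable def S (D : ℝ) : ℕ :=
  sInf {n : ℕ | ∃ P Q R : ℤ × ℤ, InT D P Q R ∧ n = twiceArea P Q R}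

/-- An M-triangle: a triangle in `𝒯(D)` of minimal area. -/
def IsMTriangle (D : ℝ) (P Q R : ℤ × ℤ) : Prop :=
  InT D P Q R ∧ twiceArea P Q R = S D

/-- Sliding occurs for `D`: there are two M-triangles `OWA`, `OWB` with common
side `OW`, `A ≠ B`, and `A`, `B` strictly on the same side of the line `OW`. -/
noncomputable def Sliding (D : ℝ) : Prop :=
  ∃ O W A B : ℤ × ℤ, IsMTriangle D O W A ∧ IsMTriangle D O W B ∧ A ≠ B ∧
    0 < det2 (sub2 W O) (sub2 A O) * det2 (sub2 W O) (sub2 B O)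


/-- Admissibility of the triangle `0, u, v` with squared side bound `R`. -/
def Adm (R : ℝ) (u1 u2 v1 v2 : ℤ) : Prop :=
  R ≤ ((u1 ^ 2 + u2 ^ 2 : ℤ) : ℝ) ∧ R ≤ ((v1 ^ 2 + v2 ^ 2 : ℤ) : ℝ) ∧
  R ≤ (((v1 - u1) ^ 2 + (v2 - u2) ^ 2 : ℤ) : ℝ) ∧
  0 ≤ u1 * v1 + u2 * v2 ∧ 0 ≤ u1 * (u1 - v1) + u2 * (u2 - v2) ∧
  0 ≤ v1 * (v1 - u1) + v2 * (v2 - u2)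

/-- The inequalities making `(2y+2-i, t), (y-α, H+β)` a good competitor for every relevant `H`. -/
def Good (y i t α β : ℤ) : Prop :=
  0 < i ∧ 10 * i ≤ y ∧ 0 ≤ t ∧ 2 * t ≤ y ∧ 0 ≤ α ∧ 2 * α ≤ y ∧ 0 ≤ β ∧ β ≤ t ∧ 0 ≤ 2 - i + α ∧
  4 * (y + 1) * i ≤ i ^ 2 + t ^ 2 ∧
  2 * (y : ℝ) * α ≤ 2 * √3 * y * β + α ^ 2 + β ^ 2 ∧
  2 * (√3 * y + 4 * √3 / 3) * ((t : ℝ) - β) ≤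
    2 * y * (2 - i + α) + (2 - i + α) ^ 2 + ((t : ℝ) - β) ^ 2 ∧
  (2 * (y : ℝ) + 2 - i) * β - t * (y - α) ≤ i * (√3 * y)

lemma r3 : (√3 : ℝ) ^ 2 = 3 := Real.sq_sqrt (by norm_num)
lemma r3lo : (989 / 571 : ℝ) < √3 := Real.lt_sqrt_of_sq_lt (by norm_num)
lemma r3hi : (√3 : ℝ) < 1351 / 780 := by
  rw [Real.sqrt_lt' (by norm_num)]; norm_num

lemma side3 (R y e H γ c : ℝ) (hγ0 : 0 ≤ γ) (hcγ : γ ≤ c) (h1 : R ≤ (2 * y + 2) ^ 2)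
    (h2 : R ≤ y ^ 2 + H ^ 2) (hcc : (2 * y + 2) ^ 2 ≤ y ^ 2 + c ^ 2)
    (h : 2 * c * γ ≤ 2 * y * e + e ^ 2 + γ ^ 2) : R ≤ (y + e) ^ 2 + (H - γ) ^ 2 := by
  rcases le_total H c with h' | h'
  · have := mul_nonneg hγ0 (sub_nonneg.2 h')
    linarith
  · have := mul_nonneg (sub_nonneg.2 h') (by linarith : (0 : ℝ) ≤ H + c - 2 * γ)
    linarith

set_option maxHeartbeats 2000000 in
lemma core (R : ℝ) (y H i t α β : ℤ) (hy : 100 ≤ y) (hg : Good y i t α β)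
    (h1 : R ≤ (2 * (y : ℝ) + 2) ^ 2) (h2 : R ≤ (y : ℝ) ^ 2 + (H : ℝ) ^ 2)
    (hH : 3 * y ^ 2 < H ^ 2) (hH0 : 0 < H) (hH2 : H ≤ 2 * y) :
    Adm R (2 * y + 2 - i) t (y - α) (H + β) ∧
      0 < (2 * y + 2 - i) * (H + β) - t * (y - α) ∧
      (2 * y + 2 - i) * (H + β) - t * (y - α) < (2 * y + 2) * H := by
  obtain ⟨g1, g2, g3, g4, g5, g6, g7, g8, g9, g10, g11, g12, g13⟩ := hg
  have hr := r3
  have hrlo := r3lo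
  have hrhi := r3hi
  have hyR : (100 : ℝ) ≤ y := by exact_mod_cast hy
  have hHr : √3 * (y : ℝ) < H := by
    have : (3 : ℝ) * y ^ 2 < H ^ 2 := by exact_mod_cast hH
    have hH0' : (0 : ℝ) < H := by exact_mod_cast hH0
    nlinarith [mul_pos (by linarith : (0 : ℝ) < √3) (by linarith : (0 : ℝ) < (y : ℝ))]
  have hH17 : 17 * y ≤ 10 * H := by
    have : (17 : ℝ) * y ≤ 10 * H := by nlinarith
    exact_mod_cast this
  have g1R : (0 : ℝ) < i := by exact_mod_cast g1
  have g7R : (0 : ℝ) ≤ β := by exact_mod_cast g7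
  have g8R : (β : ℝ) ≤ t := by exact_mod_cast g8
  have g4R : 2 * (t : ℝ) ≤ y := by exact_mod_cast g4
  refine ⟨⟨?_, ?_, ?_, ?_, ?_, ?_⟩, ?_, ?_⟩
  · push_cast
    have : 4 * ((y : ℝ) + 1) * i ≤ i ^ 2 + t ^ 2 := by exact_mod_cast g10
    nlinarith
  · push_cast
    nlinarith [mul_nonneg g7R (by linarith : (0 : ℝ) ≤ H - √3 * y)]
  · push_cast
    have e : ((y : ℝ) - α - (2 * y + 2 - i)) ^ 2 + ((H : ℝ) + β - t) ^ 2
        = ((y : ℝ) + (2 - i + α)) ^ 2 + ((H : ℝ) - (t - β)) ^ 2 := by ring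
    rw [e]
    set γ : ℝ := (t : ℝ) - β with hγ
    have hγ0 : 0 ≤ γ := by linarith
    set c : ℝ := √3 * y + 4 * √3 / 3 with hc
    have hcc : (2 * (y : ℝ) + 2) ^ 2 ≤ (y : ℝ) ^ 2 + c ^ 2 := by
      have : c ^ 2 = 3 * (y : ℝ) ^ 2 + 8 * y + 16 / 3 := by
        rw [hc]; linear_combination ((y : ℝ) ^ 2 + 8 / 3 * y + 16 / 9) * hr
      rw [this]; nlinarith
    refine side3 R y (2 - i + α) H γ c hγ0 ?_ h1 h2 hcc g12
    have : (0 : ℝ) ≤ (√3 - 1) * y := mul_nonneg (by linarith) (by linarith)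
    rw [hc, hγ]
    linarith
  · have : 0 ≤ t * (H + β) := by positivity
    nlinarith [mul_nonneg (by linarith : (0 : ℤ) ≤ 2 * y + 2 - i) (by linarith : (0 : ℤ) ≤ y - α)]
  · have a1 : t * (H + β - t) ≤ t * (2 * y) := mul_le_mul_of_nonneg_left (by linarith) g3
    have a2 : t * (2 * y) ≤ y * y := by nlinarith
    have a3 : (y + 1) * y ≤ (2 * y + 2 - i) * (2 * y + 2 - i - (y - α)) + 0 * y := by
      nlinarith [mul_nonneg (by linarith : (0 : ℤ) ≤ 2 * y + 2 - i - (y + 1)) (by linarith : (0 : ℤ) ≤ y + 2 - i + α), mul_nonneg (by linarith : (0 : ℤ) ≤ y) g9]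
    nlinarith
  · have a1 : (y - α) * (y + 2 - i + α) ≤ (y + 1) ^ 2 := by
      nlinarith [sq_nonneg (2 * α + 2 - i), mul_nonneg g1.le (by linarith : (0 : ℤ) ≤ 2 * y + 2 - i)]
    have a2 : (17 * y) * (12 * y) ≤ (10 * (H + β)) * (10 * (H + β - t)) :=
      mul_le_mul (by linarith) (by linarith) (by linarith) (by linarith)
    nlinarith
  · have a1 : (19 * y) * (17 * y) ≤ (10 * (2 * y + 2 - i)) * (10 * (H + β)) :=
      mul_le_mul (by linarith) (by linarith) (by linarith) (by linarith)
    have a2 : 2 * t * (y - α) ≤ y * y := mul_le_mul g4 (by linarith) (by linarith) (by linarith)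
    nlinarith
  · have : (2 * (y : ℝ) + 2 - i) * (H + β) - t * (y - α) < (2 * y + 2) * H := by
      nlinarith [mul_pos g1R (by linarith : (0 : ℝ) < H - √3 * y)]
    exact_mod_cast this

lemma lin_interp (p q lo hi y : ℤ) (h1 : lo ≤ y) (h2 : y ≤ hi) (a : 0 ≤ p * lo + q)
    (b : 0 ≤ p * hi + q) : 0 ≤ p * y + q := by
  rcases le_total 0 p with h | h
  · nlinarith [mul_nonneg h (sub_nonneg.2 h1)]
  · nlinarith [mul_nonneg (neg_nonneg.2 h) (sub_nonneg.2 h2)]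

/-- Integer check at a single value of `y`. -/
def chk (y i t α β : ℤ) : Bool :=
  decide (0 < i) && decide (10 * i ≤ y) && decide (0 ≤ t) && decide (2 * t ≤ y) &&
  decide (0 ≤ α) && decide (2 * α ≤ y) && decide (0 ≤ β) && decide (β ≤ t) &&
  decide (0 ≤ 2 - i + α) && decide (4 * (y + 1) * i ≤ i ^ 2 + t ^ 2) &&
  decide (0 ≤ (1978 * β - 1142 * α) * y + 571 * (α ^ 2 + β ^ 2)) &&
  decide (0 ≤ (1560 * (2 - i + α) - 2702 * (t - β)) * y +
    (780 * ((2 - i + α) ^ 2 + (t - β) ^ 2) - 3604 * (t - β))) &&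
  decide (0 ≤ (989 * i - 571 * (2 * β - t)) * y + (-571) * ((2 - i) * β + t * α))

lemma good_of_chk (lo hi y i t α β : ℤ) (hlo : 0 ≤ lo) (h1 : lo ≤ y) (h2 : y ≤ hi)
    (a : chk lo i t α β = true) (b : chk hi i t α β = true) : Good y i t α β := by
  simp only [chk, Bool.and_eq_true, decide_eq_true_eq] at a b
  obtain ⟨⟨⟨⟨⟨⟨⟨⟨⟨⟨⟨⟨a1, a2⟩, a3⟩, a4⟩, a5⟩, a6⟩, a7⟩, a8⟩, a9⟩, a10⟩, a11⟩, a12⟩, a13⟩ := a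
  obtain ⟨⟨⟨⟨⟨⟨⟨⟨⟨⟨⟨⟨b1, b2⟩, b3⟩, b4⟩, b5⟩, b6⟩, b7⟩, b8⟩, b9⟩, b10⟩, b11⟩, b12⟩, b13⟩ := b
  have c11 := lin_interp _ _ lo hi y h1 h2 a11 b11
  have c12 := lin_interp _ _ lo hi y h1 h2 a12 b12
  have c13 := lin_interp _ _ lo hi y h1 h2 a13 b13
  have hrlo := r3lo
  have hrhi := r3hi
  have hy0 : (0 : ℝ) ≤ y := by exact_mod_cast hlo.trans h1
  have g1R : (0 : ℝ) < i := by exact_mod_cast a1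
  have g7R : (0 : ℝ) ≤ β := by exact_mod_cast a7
  have g8R : (β : ℝ) ≤ t := by exact_mod_cast a8
  refine ⟨a1, by linarith, a3, by linarith, a5, by linarith, a7, a8, a9, ?_, ?_, ?_, ?_⟩
  · nlinarith [mul_nonneg a1.le (sub_nonneg.2 h2)]
  · have h : (0 : ℝ) ≤ (1978 * β - 1142 * α) * y + 571 * (α ^ 2 + β ^ 2) := by exact_mod_cast c11
    have := mul_nonneg (mul_nonneg hy0 g7R) (sub_nonneg.2 hrlo.le)
    linarith
  · have h : (0 : ℝ) ≤ (1560 * (2 - i + α) - 2702 * (t - β)) * y +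
      (780 * ((2 - i + α) ^ 2 + (t - β) ^ 2) - 3604 * (t - β)) := by exact_mod_cast c12
    have e1 := mul_nonneg (mul_nonneg hy0 (sub_nonneg.2 g8R)) (sub_nonneg.2 hrhi.le)
    have e2 := mul_nonneg (sub_nonneg.2 g8R) (sub_nonneg.2 hrhi.le)
    have e3 := sub_nonneg.2 g8R
    linarith
  · have h : (0 : ℝ) ≤ (989 * i - 571 * (2 * β - t)) * y + (-571) * ((2 - i) * β + t * α) := by
      exact_mod_cast c13
    have := mul_nonneg (mul_nonneg hy0 g1R.le) (sub_nonneg.2 hrlo.le)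
    linarith

/-- A table covers `[lo, top]`; `e` tells whether all entries must be even. -/
def covers (e : Bool) : ℤ → List (ℤ × ℤ × ℤ × ℤ × ℤ) → ℤ → Bool
  | lo, [], top => decide (top < lo)
  | lo, (hi, i, t, α, β) :: l, top =>
    decide (0 ≤ lo) && chk lo i t α β && chk hi i t α β &&
    (if e then decide (i % 2 = 0) && decide (t % 2 = 0) && decide (α % 2 = 0) && decide (β % 2 = 0)
      else decide ((i - t) % 2 = 0) && decide ((α - β) % 2 = 0)) && covers e (hi + 1) l top

lemma good_of_covers (e : Bool) (l : List (ℤ × ℤ × ℤ × ℤ × ℤ)) (lo top : ℤ)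
    (h : covers e lo l top = true) (y : ℤ) (h1 : lo ≤ y) (h2 : y ≤ top) :
    ∃ i t α β, Good y i t α β ∧ (if e then (i % 2 = 0 ∧ t % 2 = 0 ∧ α % 2 = 0 ∧ β % 2 = 0)
      else ((i - t) % 2 = 0 ∧ (α - β) % 2 = 0)) := by
  induction l generalizing lo with
  | nil => simp [covers] at h; omega
  | cons x l ih =>
    obtain ⟨hi, i, t, α, β⟩ := x
    simp only [covers, Bool.and_eq_true] at h
    obtain ⟨⟨⟨⟨h0, ha⟩, hb⟩, hc⟩, hd⟩ := h
    by_cases hy : y ≤ hi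
    · refine ⟨i, t, α, β, good_of_chk lo hi y i t α β (by simpa using h0) h1 hy ha hb, ?_⟩
      cases e <;> simp_all
    · exact ih (hi + 1) hd (by omega)

/-- Competitors for the odd-parity-allowed case. -/
def tableOdd : List (ℤ × ℤ × ℤ × ℤ × ℤ) :=
  [(1630, 1, 85, 73, 41), (1710, 1, 91, 78, 44), (1900, 1, 95, 82, 46), (2340, 1, 101, 87, 49)]

/-- Competitors with all entries even. -/
def tableEven : List (ℤ × ℤ × ℤ × ℤ × ℤ) :=
  [(2037, 4, 184, 160, 88), (2177, 2, 132, 114, 64), (2311, 2, 136, 118, 66), (2319, 32, 544, 486, 244),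
   (2454, 4, 200, 174, 96), (2512, 6, 252, 220, 120), (2535, 12, 350, 308, 164), (2539, 16, 410, 362, 190),
   (2737, 2, 148, 128, 72), (2916, 4, 216, 188, 104), (2931, 24, 530, 470, 244), (2944, 26, 554, 492, 254),
   (2991, 10, 346, 304, 164), (3151, 2, 160, 138, 78), (3361, 2, 164, 142, 80), (3527, 2, 168, 146, 82),
   (3604, 4, 244, 212, 118), (3871, 2, 176, 152, 86), (4049, 2, 180, 156, 88), (4170, 4, 260, 226, 126),
   (4323, 6, 328, 286, 158), (4607, 2, 192, 166, 94), (4801, 2, 196, 170, 96), (4868, 12, 486, 426, 232),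
   (4997, 2, 204, 176, 100), (5260, 4, 292, 254, 142), (5617, 2, 212, 184, 104), (6031, 2, 220, 190, 108),
   (6349, 4, 320, 278, 156), (6483, 6, 404, 352, 196), (6961, 2, 236, 204, 116), (7199, 2, 240, 208, 118),
   (7617, 4, 352, 306, 172), (8191, 2, 256, 222, 126), (8464, 2, 264, 228, 130), (9000, 4, 380, 330, 186),
   (9247, 2, 272, 236, 134), (9799, 2, 280, 242, 138), (10207, 2, 288, 250, 142), (10951, 2, 296, 256, 146),
   (11249, 2, 300, 260, 148), (12100, 4, 440, 382, 216), (12903, 4, 456, 396, 224), (13777, 2, 332, 288, 164),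
   (14791, 2, 344, 298, 170)]

lemma coversOdd : covers false 1414 tableOdd 2000 = true := by decide +kernel
lemma coversEven : covers true 2000 tableEven 14790 = true := by decide +kernel

lemma near (s : ℤ) : ∃ s' a : ℤ, s ≤ s' ∧ s' ≤ s + 2 ∧
    (a : ℝ) - √3 * s' ≤ 1 / 4 ∧ -(1 / 4) ≤ (a : ℝ) - √3 * s' := by
  have hrlo := r3lo
  have hrhi := r3hi
  have hn1 := Int.floor_le (√3 * (s : ℝ))
  have hn2 := Int.lt_floor_add_one (√3 * (s : ℝ))
  set n := ⌊√3 * (s : ℝ)⌋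
  by_cases c1 : √3 * (s : ℝ) - n ≤ 1 / 4
  · exact ⟨s, n, by omega, by omega, by linarith, by linarith⟩
  by_cases c2 : √3 * (s : ℝ) - n ≤ 0.517
  · refine ⟨s + 1, n + 2, by omega, by omega, ?_, ?_⟩ <;> push_cast <;> linarith
  by_cases c3 : √3 * (s : ℝ) - n ≤ 3 / 4
  · refine ⟨s + 2, n + 4, by omega, by omega, ?_, ?_⟩ <;> push_cast <;> linarith
  · refine ⟨s, n + 1, by omega, by omega, ?_, ?_⟩ <;> push_cast <;> linarith

lemma exists_root (y : ℤ) (hy : 0 ≤ y) : ∃ s : ℤ, 1 ≤ s ∧ y + 1 ≤ 2 * s ^ 2 ∧ 2 * (s - 1) ^ 2 ≤ y := by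
  have hex : ∃ s : ℕ, y + 1 ≤ 2 * (s : ℤ) ^ 2 := ⟨(y + 1).toNat, by
    rw [Int.toNat_of_nonneg (by omega)]; nlinarith⟩
  classical
  have h1 := Nat.find_spec hex
  have h0 : Nat.find hex ≠ 0 := by
    intro h; rw [h] at h1; norm_num at h1; omega
  obtain ⟨k, hk⟩ := Nat.exists_eq_succ_of_ne_zero h0
  have h2 := Nat.find_min hex (m := k) (by omega)
  refine ⟨(Nat.find hex : ℤ), by omega, h1, ?_⟩
  rw [hk]; push_cast
  have : (k : ℤ) + 1 - 1 = k := by ring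
  rw [this]; omega

set_option maxHeartbeats 1000000 in
lemma good_large (y : ℤ) (hy : 14791 ≤ y) : ∃ s a : ℤ, Good y 2 (4 * s) (2 * a) (2 * s - 2) := by
  obtain ⟨s0, h0, h1, h2⟩ := exists_root y (by omega)
  obtain ⟨s, a, k1, k2, k3, k4⟩ := near s0
  have hs1 : y + 1 ≤ 2 * s ^ 2 := by nlinarith
  have hs86 : 86 ≤ s := by nlinarith
  have hs2 : 2 * (s - 3) ^ 2 ≤ y := by nlinarith
  have hrlo := r3lo
  have hrhi := r3hi
  have hr := r3
  have hsR : (86 : ℝ) ≤ s := by exact_mod_cast hs86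
  have hyR : (14791 : ℝ) ≤ y := by exact_mod_cast hy
  have hs1R : (y : ℝ) + 1 ≤ 2 * s ^ 2 := by exact_mod_cast hs1
  have hs2R : 2 * ((s : ℝ) - 3) ^ 2 ≤ y := by exact_mod_cast hs2
  obtain ⟨ε, hε⟩ : ∃ ε : ℝ, ε = (a : ℝ) - √3 * s := ⟨_, rfl⟩
  rw [← hε] at k3 k4
  have ha : (a : ℝ) = √3 * s + ε := by rw [hε]; ring
  have ha0 : 0 ≤ a := by
    have : (0 : ℝ) ≤ a := by rw [ha]; nlinarith
    exact_mod_cast this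
  have ha2 : a ≤ 2 * s := by
    have : (a : ℝ) ≤ 2 * s := by rw [ha]; nlinarith
    exact_mod_cast this
  have h8 : 8 * s ≤ y := by nlinarith
  have hsy : 100 * (s : ℝ) ≤ y := by nlinarith
  have hrs : √3 * (s : ℝ) ≤ 1.7321 * s := by
    apply mul_le_mul_of_nonneg_right <;> linarith
  have hrs' : 1.732 * (s : ℝ) ≤ √3 * s := by
    apply mul_le_mul_of_nonneg_right <;> linarith
  have hry : √3 * (y : ℝ) ≤ 1.7321 * y := by
    apply mul_le_mul_of_nonneg_right <;> linarith
  have hry' : 1.732 * (y : ℝ) ≤ √3 * y := by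
    apply mul_le_mul_of_nonneg_right <;> linarith
  have haa : (a : ℝ) ^ 2 = 3 * s ^ 2 + 2 * (√3 * s) * ε + ε ^ 2 := by
    rw [ha]; linear_combination (s : ℝ) ^ 2 * hr
  have hε2 := sq_nonneg ε
  refine ⟨s, a, by norm_num, by omega, by omega, by omega, by omega, by omega, by omega, by omega,
    by omega, ?_, ?_, ?_, ?_⟩
  · nlinarith
  · push_cast
    have e1 := mul_nonneg (sub_nonneg.2 k3) (by linarith : (0 : ℝ) ≤ y - 2 * (√3 * s))
    have e2 : (y : ℝ) * a = √3 * y * s + y * ε := by rw [ha]; ring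
    have : (y : ℝ) * a ≤ √3 * y * (s - 1) + a ^ 2 + (s - 1) ^ 2 := by
      rw [e2, haa]; linarith
    linarith
  · push_cast
    have e1 := mul_nonneg (by linarith : (0 : ℝ) ≤ ε + 1 / 4) (by linarith : (0 : ℝ) ≤ y + 2 * (√3 * s))
    have e2 : (y : ℝ) * a = √3 * y * s + y * ε := by rw [ha]; ring
    have : (√3 * y + 4 * √3 / 3) * ((s : ℝ) + 1) ≤ y * a + a ^ 2 + (s + 1) ^ 2 := by
      rw [e2, haa]; linarith
    linarith
  · push_cast
    have e1 : (s : ℝ) * a = √3 * s * s + s * ε := by rw [ha]; ring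
    have e2 := mul_nonneg (sub_nonneg.2 k3) (by linarith : (0 : ℝ) ≤ s)
    have e3 := mul_le_mul_of_nonneg_right hrs (by linarith : (0 : ℝ) ≤ s)
    have e4 := mul_nonneg (by linarith : (0 : ℝ) ≤ (s : ℝ) - 86) (by linarith : (0 : ℝ) ≤ (s : ℝ))
    have : 4 * ((s : ℝ) * a) ≤ (2 + √3) * y := by
      rw [e1]; linarith
    linarith

lemma exists_even (y : ℤ) (hy : 2000 ≤ y) : ∃ i t α β, Good y i t α β ∧
    i % 2 = 0 ∧ t % 2 = 0 ∧ α % 2 = 0 ∧ β % 2 = 0 := by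
  rcases le_or_gt y 14790 with h | h
  · simpa using good_of_covers true _ _ _ coversEven y hy h
  · obtain ⟨s, a, hg⟩ := good_large y (by omega)
    exact ⟨_, _, _, _, hg, by omega, by omega, by omega, by omega⟩

lemma exists_odd (y : ℤ) (hy : 1414 ≤ y) : ∃ i t α β, Good y i t α β ∧
    (i - t) % 2 = 0 ∧ (α - β) % 2 = 0 := by
  rcases le_or_gt y 2000 with h | h
  · simpa using good_of_covers false _ _ _ coversOdd y hy h
  · obtain ⟨i, t, α, β, hg, h1, h2, h3, h4⟩ := exists_even y h.le
    exact ⟨i, t, α, β, hg, by omega, by omega⟩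

lemma adm_of (R : ℝ) (c d m V1 V2 x k N : ℤ) (hN : c ^ 2 + d ^ 2 = N) (hN0 : 0 < N) (hm : 0 ≤ m)
    (hx : c * V1 + d * V2 = x) (hk : c * V2 - d * V1 = k)
    (h1 : R ≤ (m : ℝ) ^ 2 * N) (h2 : (N : ℝ) * R ≤ (x : ℝ) ^ 2 + (k : ℝ) ^ 2)
    (h3 : (N : ℝ) * R ≤ ((m : ℝ) * N - x) ^ 2 + (k : ℝ) ^ 2) (h4 : 0 ≤ x) (h5 : x ≤ m * N)
    (h6 : x * (m * N - x) ≤ k ^ 2) : Adm R (m * c) (m * d) V1 V2 := by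
  have hNR : (0 : ℝ) < N := by exact_mod_cast hN0
  have e1 : N * (V1 ^ 2 + V2 ^ 2) = x ^ 2 + k ^ 2 := by subst hx hk hN; ring
  have e2 : N * ((V1 - m * c) ^ 2 + (V2 - m * d) ^ 2) = (m * N - x) ^ 2 + k ^ 2 := by
    subst hx hk hN; ring
  have e3 : N * (V1 * (V1 - m * c) + V2 * (V2 - m * d)) = k ^ 2 - x * (m * N - x) := by
    subst hx hk hN; ring
  refine ⟨?_, ?_, ?_, ?_, ?_, ?_⟩
  · have : (m * c) ^ 2 + (m * d) ^ 2 = m ^ 2 * N := by rw [← hN]; ring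
    rw [this]; push_cast; exact h1
  · refine le_of_mul_le_mul_left ?_ hNR
    refine h2.trans (le_of_eq ?_); exact_mod_cast e1.symm
  · refine le_of_mul_le_mul_left ?_ hNR
    refine h3.trans (le_of_eq ?_); exact_mod_cast e2.symm
  · have : m * c * V1 + m * d * V2 = m * x := by rw [← hx]; ring
    rw [this]; positivity
  · have : m * c * (m * c - V1) + m * d * (m * d - V2) = m * (m * N - x) := by
      rw [← hx, ← hN]; ring
    rw [this]; exact mul_nonneg hm (by linarith)
  · exact nonneg_of_mul_nonneg_right (by rw [e3]; linarith : 0 ≤ N * _) hN0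

lemma of_adm (R : ℝ) (c d m V1 V2 x k N : ℤ) (hN : c ^ 2 + d ^ 2 = N) (hN0 : 0 < N) (hm : 0 < m)
    (hx : c * V1 + d * V2 = x) (hk : c * V2 - d * V1 = k) (h : Adm R (m * c) (m * d) V1 V2) :
    R ≤ (m : ℝ) ^ 2 * N ∧ (N : ℝ) * R ≤ (x : ℝ) ^ 2 + (k : ℝ) ^ 2 ∧
    (N : ℝ) * R ≤ ((m : ℝ) * N - x) ^ 2 + (k : ℝ) ^ 2 ∧ 0 ≤ x ∧ x ≤ m * N ∧
    x * (m * N - x) ≤ k ^ 2 := by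
  have hNR : (0 : ℝ) < N := by exact_mod_cast hN0
  have e1 : N * (V1 ^ 2 + V2 ^ 2) = x ^ 2 + k ^ 2 := by subst hx hk hN; ring
  have e2 : N * ((V1 - m * c) ^ 2 + (V2 - m * d) ^ 2) = (m * N - x) ^ 2 + k ^ 2 := by
    subst hx hk hN; ring
  have e3 : N * (V1 * (V1 - m * c) + V2 * (V2 - m * d)) = k ^ 2 - x * (m * N - x) := by
    subst hx hk hN; ring
  obtain ⟨h1, h2, h3, h4, h5, h6⟩ := h
  refine ⟨?_, ?_, ?_, ?_, ?_, ?_⟩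
  · have : (m * c) ^ 2 + (m * d) ^ 2 = m ^ 2 * N := by rw [← hN]; ring
    rw [this] at h1; push_cast at h1; exact h1
  · refine (mul_le_mul_of_nonneg_left h2 hNR.le).trans (le_of_eq ?_); exact_mod_cast e1
  · refine (mul_le_mul_of_nonneg_left h3 hNR.le).trans (le_of_eq ?_); exact_mod_cast e2
  · have : m * c * V1 + m * d * V2 = m * x := by rw [← hx]; ring
    rw [this] at h4; exact nonneg_of_mul_nonneg_right h4 hm
  · have : m * c * (m * c - V1) + m * d * (m * d - V2) = m * (m * N - x) := by
      rw [← hx, ← hN]; ring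
    rw [this] at h5; linarith [nonneg_of_mul_nonneg_right h5 hm]
  · have := mul_nonneg hN0.le h6
    linarith

/-- The basic competitor. -/
lemma basic (R : ℝ) (hR : 4000000 ≤ R) : ∃ q : ℤ, 0 < q ∧ Adm R (8 * q) 0 (4 * q) (7 * q) ∧
    56 * (q : ℝ) ^ 2 ≤ 0.88202 * R := by
  have hs0 : (2000 : ℝ) ≤ √R := Real.le_sqrt_of_sq_le (by norm_num; exact hR)
  have hs := Real.sq_sqrt (by linarith : (0 : ℝ) ≤ R)
  set s := √R
  have h1 := Int.le_ceil (s / 8)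
  have h2 := Int.ceil_lt_add_one (s / 8)
  set q := ⌈s / 8⌉
  have hq : (0 : ℝ) < q := by linarith
  have hq' : 0 < q := by exact_mod_cast hq
  have h8 : R ≤ 64 * (q : ℝ) ^ 2 := by nlinarith
  refine ⟨q, hq', ⟨?_, ?_, ?_, ?_, ?_, ?_⟩, ?_⟩
  · push_cast; nlinarith
  · push_cast; nlinarith
  · push_cast; nlinarith
  · nlinarith
  · nlinarith
  · nlinarith
  · have : (q : ℝ) ≤ 0.1255 * s := by linarith
    have := mul_self_le_mul_self hq.le this
    rw [← hs]; nlinarith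

/-- Scaled embedding. -/
lemma emb (R : ℝ) (c d N X Y X' Y' u1 u2 v1 v2 : ℤ) (hN : c ^ 2 + d ^ 2 = N) (hN0 : 0 < N)
    (h1 : 2 * u1 = c * X - d * Y) (h2 : 2 * u2 = d * X + c * Y)
    (h3 : 2 * v1 = c * X' - d * Y') (h4 : 2 * v2 = d * X' + c * Y')
    (h : Adm (4 * R / N) X Y X' Y') :
    Adm R u1 u2 v1 v2 ∧ 4 * (u1 * v2 - u2 * v1) = N * (X * Y' - Y * X') := by
  have hNR : (0 : ℝ) < N := by exact_mod_cast hN0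
  have key : ∀ p q : ℤ, 4 * p = N * q → 4 * R / N ≤ (q : ℝ) → R ≤ (p : ℝ) := by
    intro p q hpq hq
    rw [div_le_iff₀ hNR] at hq
    have : (4 : ℝ) * p = N * q := by exact_mod_cast hpq
    linarith
  have key2 : ∀ p q : ℤ, 4 * p = N * q → 0 ≤ q → 0 ≤ p := by
    intro p q hpq hq
    have := mul_nonneg hN0.le hq
    linarith
  obtain ⟨g1, g2, g3, g4, g5, g6⟩ := h
  have i1 : ∀ a b e f A B E F : ℤ, 2 * a = c * A - d * B → 2 * b = d * A + c * B →
      2 * e = c * E - d * F → 2 * f = d * E + c * F → 4 * (a * e + b * f) = N * (A * E + B * F) := by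
    intro a b e f A B E F k1 k2 k3 k4
    have : 4 * (a * e + b * f) = (2 * a) * (2 * e) + (2 * b) * (2 * f) := by ring
    rw [this, k1, k2, k3, k4, ← hN]; ring
  refine ⟨⟨?_, ?_, ?_, ?_, ?_, ?_⟩, ?_⟩
  · refine key _ _ ?_ g1
    simp only [pow_two]; exact i1 _ _ _ _ _ _ _ _ h1 h2 h1 h2
  · refine key _ _ ?_ g2
    simp only [pow_two]; exact i1 _ _ _ _ _ _ _ _ h3 h4 h3 h4
  · refine key _ _ ?_ g3
    simp only [pow_two]; apply i1 <;> linarith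
  · exact key2 _ _ (i1 _ _ _ _ _ _ _ _ h1 h2 h3 h4) g4
  · refine key2 _ _ ?_ g5
    apply i1 <;> linarith
  · refine key2 _ _ ?_ g6
    apply i1 <;> linarith
  · have : 4 * (u1 * v2 - u2 * v1) = (2 * u1) * (2 * v2) - (2 * u2) * (2 * v1) := by ring
    rw [this, h1, h2, h3, h4, ← hN]; ring

lemma scaled_big (R : ℝ) (m H y : ℤ) (hm : 1414 ≤ m) (hy : y = m - 2) (h1 : R ≤ 4 * (m : ℝ) ^ 2)
    (h2 : R ≤ (y : ℝ) ^ 2 + (H : ℝ) ^ 2) (hH0 : 0 < H) (hH3 : 3 * (m - 1) ^ 2 < H ^ 2)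
    (hH2 : 1000 * H ^ 2 ≤ 3112 * m ^ 2) :
    Adm R (2 * m) 2 y H ∧ 0 < 2 * m * H - 2 * y ∧ 2 * m * H - 2 * y < 2 * m * H := by
  have hHy : H ≤ 2 * y := by
    by_contra! hc
    subst hy; nlinarith
  have hHm : m ≤ H := by
    by_contra! hc
    nlinarith
  subst hy
  have hHyR : (H : ℝ) ≤ 2 * (m - 2) := by exact_mod_cast hHy
  push_cast at h2
  refine ⟨⟨?_, ?_, ?_, ?_, ?_, ?_⟩, ?_, ?_⟩
  · push_cast; nlinarith
  · push_cast; exact h2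
  · push_cast; nlinarith
  · nlinarith
  · nlinarith
  · nlinarith
  · nlinarith
  · linarith

/-- Reduction to scaled form. -/
lemma scaled (R : ℝ) (m H y : ℤ) (E : Prop) (hm : 1415 ≤ m) (hE : E → 2000 ≤ m ∧ m % 2 = 1 ∧ y % 2 = 0)
    (hy : y = m - 1) (hyH : (y - H) % 2 = 0)
    (h1 : R ≤ 4 * (m : ℝ) ^ 2)
    (h2 : R ≤ (y : ℝ) ^ 2 + (H : ℝ) ^ 2) (hH0 : 0 < H) (hH3 : 3 * (m - 1) ^ 2 < H ^ 2)
    (hH2 : 1000 * H ^ 2 ≤ 3112 * m ^ 2) :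
    ∃ X Y X' Y' : ℤ, Adm R X Y X' Y' ∧ 0 < X * Y' - Y * X' ∧ X * Y' - Y * X' < 2 * m * H ∧
      (X - Y) % 2 = 0 ∧ (X' - Y') % 2 = 0 ∧ (E → X % 2 = 0 ∧ X' % 2 = 0) := by
  have hHy : H ≤ 2 * y := by
    by_contra! hc
    subst hy; nlinarith
  have hm' : m = y + 1 := by omega
  subst hm'
  have hh : R ≤ (2 * (y : ℝ) + 2) ^ 2 := by push_cast at h1; nlinarith
  have h3 : 3 * y ^ 2 < H ^ 2 := by simpa using hH3
  by_cases e : E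
  · obtain ⟨e1, e2, e3⟩ := hE e
    obtain ⟨i, t, α, β, hg, p1, p2, p3, p4⟩ := exists_even y (by omega)
    obtain ⟨c1, c2, c3⟩ := core R y H i t α β (by omega) hg hh h2 h3 hH0 hHy
    exact ⟨_, _, _, _, c1, c2, by linarith, by omega, by omega, fun _ => by omega⟩
  · obtain ⟨i, t, α, β, hg, p1, p2⟩ := exists_odd y (by omega)
    obtain ⟨c1, c2, c3⟩ := core R y H i t α β (by omega) hg hh h2 h3 hH0 hHy
    exact ⟨_, _, _, _, c1, c2, by linarith, by omega, by omega, fun h => absurd h e⟩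

lemma prelim (R : ℝ) (m N k x xb : ℝ) (hR : 4000000 ≤ R) (hm : 1 ≤ m) (hN : 1 ≤ N) (hk : 0 < k)
    (h1 : R ≤ m ^ 2 * N) (h2 : N * R ≤ x ^ 2 + k ^ 2) (h3 : N * R ≤ xb ^ 2 + k ^ 2)
    (hx : 0 ≤ x) (hxb : 0 ≤ xb) (hs : x + xb ≤ (m - 1) * N) (hL : (m - 1) ^ 2 * N < R)
    (hb : m * k ≤ 0.88202 * R) :
    k ^ 2 ≤ 0.778 * (N * R) ∧ 0.75 * (N * R) < k ^ 2 ∧ m ^ 2 * N ≤ 1.0374 * R ∧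
      k ≤ 2 * x ∧ k ≤ 2 * xb := by
  have hR0 : 0 < R := by linarith
  have hN0 : 0 < N := by linarith
  have hb2 : m ^ 2 * k ^ 2 ≤ 0.77797 * R ^ 2 := by
    have := mul_self_le_mul_self (by positivity) hb
    nlinarith
  have c1 : k ^ 2 ≤ 0.778 * (N * R) := by
    have e1 := mul_le_mul_of_nonneg_right h1 (sq_nonneg k)
    have e2 := mul_le_mul_of_nonneg_left hb2 hN0.le
    have : R * k ^ 2 ≤ R * (0.778 * (N * R)) := by
      have : 0 ≤ N * R ^ 2 := by positivity
      linarith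
    exact le_of_mul_le_mul_left this hR0
  have e4 : (m - 1) ^ 2 * N * N < R * N := mul_lt_mul_of_pos_right hL hN0
  have c2 : 0.75 * (N * R) < k ^ 2 := by
    rcases le_total x xb with h | h
    · have : 2 * x ≤ (m - 1) * N := by linarith
      have := mul_self_le_mul_self (by linarith) this
      linarith
    · have : 2 * xb ≤ (m - 1) * N := by linarith
      have := mul_self_le_mul_self (by linarith) this
      linarith
  have c3 : m ^ 2 * N ≤ 1.0374 * R := by
    have e1 := mul_le_mul_of_nonneg_left c2.le (sq_nonneg m)
    have : R * (m ^ 2 * N) ≤ R * (1.0374 * R) := by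
      have : 0 ≤ R ^ 2 := by positivity
      linarith
    exact le_of_mul_le_mul_left this hR0
  have hNR : 0 < N * R := by positivity
  refine ⟨c1, c2, c3, ?_, ?_⟩
  · refine (pow_le_pow_iff_left₀ hk.le (by linarith) two_ne_zero).1 ?_; nlinarith
  · refine (pow_le_pow_iff_left₀ hk.le (by linarith) two_ne_zero).1 ?_; nlinarith

lemma two_cd (c d : ℤ) (h : c ^ 2 + d ^ 2 = 2) : (c = 1 ∨ c = -1) ∧ (d = 1 ∨ d = -1) := by
  have h1 : c ≤ 1 := by nlinarith
  have h2 : -1 ≤ c := by nlinarith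
  have h3 : d ≤ 1 := by nlinarith
  have h4 : -1 ≤ d := by nlinarith
  interval_cases c <;> interval_cases d <;> simp_all

lemma par (c d N X Y : ℤ) (hN : c ^ 2 + d ^ 2 = N) (hN2 : N = 1 ∨ N = 2) (h1 : (X - Y) % 2 = 0)
    (h2 : N = 1 → X % 2 = 0) : ∃ u1 u2 : ℤ, 2 * u1 = c * X - d * Y ∧ 2 * u2 = d * X + c * Y := by
  rcases hN2 with h | h
  · have h2 := h2 h
    obtain ⟨p, rfl⟩ : ∃ p, X = 2 * p := ⟨X / 2, by omega⟩
    obtain ⟨q, rfl⟩ : ∃ q, Y = 2 * q := ⟨Y / 2, by omega⟩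
    exact ⟨c * p - d * q, d * p + c * q, by ring, by ring⟩
  · obtain ⟨hc, hd⟩ := two_cd c d (by omega)
    obtain ⟨p, rfl⟩ : ∃ p, X = Y + 2 * p := ⟨(X - Y) / 2, by omega⟩
    rcases hc with rfl | rfl <;> rcases hd with rfl | rfl
    · exact ⟨p, Y + p, by ring, by ring⟩
    · exact ⟨Y + p, -p, by ring, by ring⟩
    · exact ⟨-Y - p, p, by ring, by ring⟩
    · exact ⟨-p, -Y - p, by ring, by ring⟩

lemma exists_z (c d N : ℤ) (hcd : IsCoprime c d) (hN : c ^ 2 + d ^ 2 = N) (hN3 : 3 ≤ N) :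
    ∃ z1 z2 r : ℤ, c * z2 - d * z1 = -1 ∧ c * z1 + d * z2 = r ∧ 2 ≤ r ∧ r ≤ N - 2 := by
  obtain ⟨a, b, hab⟩ := hcd
  have h0 : 0 ≤ (c * b - d * a) % N := Int.emod_nonneg _ (by omega)
  have h1 : (c * b - d * a) % N < N := Int.emod_lt_of_pos _ (by omega)
  have h2 := Int.emod_add_mul_ediv (c * b - d * a) N
  set q := (c * b - d * a) / N
  set r := (c * b - d * a) % N
  have e1 : c * (-a - q * d) - d * (b - q * c) = -1 := by linear_combination -hab
  have e2 : c * (b - q * c) + d * (-a - q * d) = r := by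
    linear_combination -h2 - q * hN
  have e3 : N * ((b - q * c) ^ 2 + (-a - q * d) ^ 2) = r ^ 2 + 1 := by
    rw [← e2, ← hN]
    linear_combination (c * (-a - q * d) - d * (b - q * c) - 1) * e1
  have hdvd : N ∣ r ^ 2 + 1 := ⟨_, e3.symm⟩
  refine ⟨_, _, r, e1, e2, ?_, ?_⟩
  · by_contra! h
    have := Int.le_of_dvd (by positivity) hdvd
    have : r = 0 ∨ r = 1 := by omega
    rcases this with h | h <;> rw [h] at this <;> omega
  · by_contra! h
    have hr : r = N - 1 := by omega
    rw [hr] at hdvd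
    have : N ∣ 2 := by
      have h' : (2 : ℤ) = ((N - 1) ^ 2 + 1) - N * (N - 2) := by ring
      rw [h']; exact dvd_sub hdvd (dvd_mul_right _ _)
    have := Int.le_of_dvd (by norm_num) this
    omega

lemma main_big (R : ℝ) (hR : 4000000 ≤ R) (c d N m k x xb a1 a2 : ℤ) (hcd : IsCoprime c d)
    (hN : c ^ 2 + d ^ 2 = N) (hN3 : 3 ≤ N) (hm : 0 < m) (hk : 0 < k)
    (hx : c * a1 + d * a2 = x) (hka : c * a2 - d * a1 = k)
    (h1 : R ≤ (m : ℝ) ^ 2 * N) (h2 : (N : ℝ) * R ≤ (x : ℝ) ^ 2 + (k : ℝ) ^ 2)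
    (h3 : (N : ℝ) * R ≤ (xb : ℝ) ^ 2 + (k : ℝ) ^ 2)
    (hx0 : 0 ≤ x) (hxb0 : 0 ≤ xb) (hs : x + xb ≤ (m - 1) * N)
    (p2 : 0.75 * ((N : ℝ) * R) < (k : ℝ) ^ 2) (p3 : (m : ℝ) ^ 2 * N ≤ 1.0374 * R)
    (p4 : k ≤ 2 * x) (p5 : k ≤ 2 * xb)
    (hmin : ∀ u1 u2 v1 v2 : ℤ, Adm R u1 u2 v1 v2 → 0 < u1 * v2 - u2 * v1 →
      m * k ≤ u1 * v2 - u2 * v1) : False := by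
  obtain ⟨z1, z2, r, hz1, hz2, hr2, hrN⟩ := exists_z c d N hcd hN hN3
  have hN3R : (3 : ℝ) ≤ N := by exact_mod_cast hN3
  have hNR : 12000000 ≤ (N : ℝ) * R := by nlinarith
  have hkR : (0 : ℝ) < k := by exact_mod_cast hk
  have hk1000 : (1000 : ℝ) ≤ k := by nlinarith
  have hk1000' : 1000 ≤ k := by exact_mod_cast hk1000
  have q1 : x ^ 2 + k ^ 2 ≤ (x + r) ^ 2 + (k - 1) ^ 2 := by nlinarith
  have q2 : xb ^ 2 + k ^ 2 ≤ (m * N - (x + r)) ^ 2 + (k - 1) ^ 2 := by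
    have e1 : xb + 2 ≤ m * N - (x + r) := by linarith
    have e2 := mul_self_le_mul_self (by omega) e1
    nlinarith
  have q1R : (x : ℝ) ^ 2 + (k : ℝ) ^ 2 ≤ ((x : ℝ) + r) ^ 2 + ((k : ℝ) - 1) ^ 2 := by
    exact_mod_cast q1
  have q2R : (xb : ℝ) ^ 2 + (k : ℝ) ^ 2 ≤ ((m : ℝ) * N - (x + r)) ^ 2 + ((k : ℝ) - 1) ^ 2 := by
    exact_mod_cast q2
  have q3 : (x + r) * (m * N - (x + r)) ≤ (k - 1) ^ 2 := by
    have : ((x : ℝ) + r) * (m * N - (x + r)) ≤ ((k : ℝ) - 1) ^ 2 := by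
      have e1 := sq_nonneg ((m : ℝ) * N - 2 * (x + r))
      have e2 := mul_le_mul_of_nonneg_right p3 (by linarith : (0 : ℝ) ≤ N)
      have e3 : (k : ℝ) * k ≥ 1000 * k := mul_le_mul_of_nonneg_right hk1000 hkR.le
      nlinarith
    exact_mod_cast this
  have hadm := adm_of R c d m (a1 + z1) (a2 + z2) (x + r) (k - 1) N hN (by omega) hm.le
    (by rw [← hx, ← hz2]; ring) (by linear_combination hka + hz1) h1
    (by push_cast; linarith) (by push_cast; linarith) (by omega)
    (by nlinarith) q3
  have hdet : m * c * (a2 + z2) - m * d * (a1 + z1) = m * (k - 1) := by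
    linear_combination m * hka + m * hz1
  have := hmin _ _ _ _ hadm (by rw [hdet]; exact mul_pos hm (by omega))
  rw [hdet] at this
  nlinarith

set_option maxHeartbeats 1000000 in
lemma main_small (R : ℝ) (hR : 4000000 ≤ R) (c d N m k x xb a1 a2 j : ℤ)
    (hN : c ^ 2 + d ^ 2 = N) (hN2 : N = 1 ∨ N = 2) (hm : 0 < m) (hk : 0 < k)
    (hx : c * a1 + d * a2 = x) (hka : c * a2 - d * a1 = k)
    (h1 : R ≤ (m : ℝ) ^ 2 * N) (h2 : (N : ℝ) * R ≤ (x : ℝ) ^ 2 + (k : ℝ) ^ 2)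
    (h3 : (N : ℝ) * R ≤ (xb : ℝ) ^ 2 + (k : ℝ) ^ 2)
    (hx0 : 0 ≤ x) (hxb0 : 0 ≤ xb) (hj : 0 < j) (hxb : xb = m * N - x - j * N)
    (hL : ((m : ℝ) - 1) ^ 2 * N < R)
    (p1 : (k : ℝ) ^ 2 ≤ 0.778 * ((N : ℝ) * R))
    (p2 : 0.75 * ((N : ℝ) * R) < (k : ℝ) ^ 2)
    (hmin : ∀ u1 u2 v1 v2 : ℤ, Adm R u1 u2 v1 v2 → 0 < u1 * v2 - u2 * v1 →
      m * k ≤ u1 * v2 - u2 * v1) : False := by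
  have hmR : (0 : ℝ) < m := by exact_mod_cast hm
  have hN0 : 0 < N := by omega
  obtain ⟨H, y, hH, hy, hyH, hE, g2⟩ : ∃ H y : ℤ, N * H = 2 * k ∧ (y = m - 1 ∨ y = m - 2) ∧
      (y - H) % 2 = 0 ∧ (N = 1 → y % 2 = 0 ∧ H % 2 = 0) ∧
      4 * R / N ≤ (y : ℝ) ^ 2 + (H : ℝ) ^ 2 := by
    have aux : ∀ y X Xb H : ℤ, 0 ≤ X → 0 ≤ Xb → (X ≤ y ∨ Xb ≤ y) →
        4 * R / N ≤ (X : ℝ) ^ 2 + (H : ℝ) ^ 2 → 4 * R / N ≤ (Xb : ℝ) ^ 2 + (H : ℝ) ^ 2 →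
        4 * R / N ≤ (y : ℝ) ^ 2 + (H : ℝ) ^ 2 := by
      intro y X Xb H hX hXb h e1 e2
      have hX' : (0 : ℝ) ≤ X := by exact_mod_cast hX
      have hXb' : (0 : ℝ) ≤ Xb := by exact_mod_cast hXb
      rcases h with h | h
      · have h' : (X : ℝ) ≤ y := by exact_mod_cast h
        nlinarith
      · have h' : (Xb : ℝ) ≤ y := by exact_mod_cast h
        nlinarith
    rcases hN2 with rfl | rfl
    · have w1 : 4 * R / ((1 : ℤ) : ℝ) ≤ ((2 * x : ℤ) : ℝ) ^ 2 + ((2 * k : ℤ) : ℝ) ^ 2 := by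
        push_cast at h2 ⊢; linarith
      have w2 : 4 * R / ((1 : ℤ) : ℝ) ≤ ((2 * xb : ℤ) : ℝ) ^ 2 + ((2 * k : ℤ) : ℝ) ^ 2 := by
        push_cast at h3 ⊢; linarith
      rcases Int.emod_two_eq_zero_or_one m with e | e
      · exact ⟨2 * k, m - 2, by ring, Or.inr rfl, by omega, fun _ => by omega,
          aux _ (2 * x) (2 * xb) _ (by omega) (by omega) (by omega) w1 w2⟩
      · exact ⟨2 * k, m - 1, by ring, Or.inl rfl, by omega, fun _ => by omega,
          aux _ (2 * x) (2 * xb) _ (by omega) (by omega) (by omega) w1 w2⟩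
    · have w1 : 4 * R / ((2 : ℤ) : ℝ) ≤ (x : ℝ) ^ 2 + (k : ℝ) ^ 2 := by
        push_cast at h2 ⊢; linarith
      have w2 : 4 * R / ((2 : ℤ) : ℝ) ≤ (xb : ℝ) ^ 2 + (k : ℝ) ^ 2 := by
        push_cast at h3 ⊢; linarith
      have hpar : (x - k) % 2 = 0 := by
        obtain ⟨hc, hd⟩ := two_cd c d hN
        rcases hc with rfl | rfl <;> rcases hd with rfl | rfl <;> omega
      rcases Int.emod_two_eq_zero_or_one (m - k) with e | e
      · exact ⟨k, m - 2, by ring, Or.inr rfl, by omega, fun h => by omega,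
          aux _ x xb _ (by omega) (by omega) (by omega) w1 w2⟩
      · exact ⟨k, m - 1, by ring, Or.inl rfl, by omega, fun h => by omega,
          aux _ x xb _ (by omega) (by omega) (by omega) w1 w2⟩
  have hNR : (0 : ℝ) < N := by exact_mod_cast hN0
  have hHR : (N : ℝ) * H = 2 * k := by exact_mod_cast hH
  have hH0 : 0 < H := by
    by_contra! h
    nlinarith
  obtain ⟨R', hR'⟩ : ∃ R', R' = 4 * R / (N : ℝ) := ⟨_, rfl⟩
  have hRR : R' * N = 4 * R := by rw [hR']; field_simp
  have g1 : R' ≤ 4 * (m : ℝ) ^ 2 := by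
    refine le_of_mul_le_mul_right ?_ hNR
    linarith
  have gL : 4 * ((m : ℝ) - 1) ^ 2 < R' := by
    refine lt_of_mul_lt_mul_right ?_ hNR.le
    linarith
  have hkH : (k : ℝ) ^ 2 * 4 = (N : ℝ) ^ 2 * H ^ 2 := by
    linear_combination -((N : ℝ) * H + 2 * k) * hHR
  have hNN : (0 : ℝ) < (N : ℝ) ^ 2 := by positivity
  have gP1 : (H : ℝ) ^ 2 ≤ 0.778 * R' := by
    refine le_of_mul_le_mul_left ?_ hNN
    have : (N : ℝ) ^ 2 * (0.778 * R') = 0.778 * N * (R' * N) := by ring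
    rw [this, ← hkH, hRR]; linarith
  have gP2 : 0.75 * R' < (H : ℝ) ^ 2 := by
    refine lt_of_mul_lt_mul_left ?_ hNN.le
    have : (N : ℝ) ^ 2 * (0.75 * R') = 0.75 * N * (R' * N) := by ring
    rw [this, ← hkH, hRR]; linarith
  have hH3 : 3 * (m - 1) ^ 2 < H ^ 2 := by
    have : 3 * ((m : ℝ) - 1) ^ 2 < (H : ℝ) ^ 2 := by linarith
    exact_mod_cast this
  have hH2 : 1000 * H ^ 2 ≤ 3112 * m ^ 2 := by
    have : 1000 * (H : ℝ) ^ 2 ≤ 3112 * (m : ℝ) ^ 2 := by linarith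
    exact_mod_cast this
  have hm1415 : 1415 ≤ m := by
    by_contra! h
    have h' : (m : ℝ) ≤ 1414 := by exact_mod_cast (by omega : m ≤ 1414)
    have h2 : (N : ℝ) ≤ 2 := by exact_mod_cast (by omega : N ≤ 2)
    nlinarith
  have hm2000 : N = 1 → 2000 ≤ m := by
    intro h
    rw [h] at h1
    have : (2000 : ℝ) ≤ m := by push_cast at h1; nlinarith
    exact_mod_cast this
  rw [← hR'] at g2
  have fin : ∃ X Y X' Y' : ℤ, Adm R' X Y X' Y' ∧ 0 < X * Y' - Y * X' ∧
      X * Y' - Y * X' < 2 * m * H ∧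
      (X - Y) % 2 = 0 ∧ (X' - Y') % 2 = 0 ∧ (N = 1 → X % 2 = 0 ∧ X' % 2 = 0) := by
    rcases hy with hy | hy
    · exact scaled R' m H y (N = 1) hm1415
        (fun h => ⟨hm2000 h, by have := hE h; omega, (hE h).1⟩) hy hyH g1 g2 hH0 hH3 hH2
    · obtain ⟨t1, t2, t3⟩ := scaled_big R' m H y (by omega) hy g1 g2 hH0 hH3 hH2
      exact ⟨_, _, _, _, t1, t2, t3, by omega, hyH, fun h => by have := hE h; omega⟩
  obtain ⟨X, Y, X', Y', f1, f2, f3, f4, f5, f6⟩ := fin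
  obtain ⟨u1, u2, hu1, hu2⟩ := par c d N X Y hN hN2 f4 (fun h => (f6 h).1)
  obtain ⟨v1, v2, hv1, hv2⟩ := par c d N X' Y' hN hN2 f5 (fun h => (f6 h).2)
  rw [hR'] at f1
  obtain ⟨ha, hdet⟩ := emb R c d N X Y X' Y' u1 u2 v1 v2 hN hN0 hu1 hu2 hv1 hv2 f1
  have e1 := mul_pos hN0 f2
  have e2 := mul_lt_mul_of_pos_left f3 hN0
  have e3 : N * (2 * m * H) = 4 * (m * k) := by linear_combination 2 * m * hH
  have := hmin _ _ _ _ ha (by omega)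
  omega

lemma main_core (R : ℝ) (hR : 4000000 ≤ R) (c d m j a1 a2 : ℤ) (hcd : IsCoprime c d) (hm : 0 < m)
    (hj : 0 < j) (hA : Adm R (m * c) (m * d) a1 a2)
    (hB : Adm R (m * c) (m * d) (a1 + j * c) (a2 + j * d))
    (hk0 : 0 < c * a2 - d * a1)
    (hmin : ∀ u1 u2 v1 v2 : ℤ, Adm R u1 u2 v1 v2 → 0 < u1 * v2 - u2 * v1 →
      m * (c * a2 - d * a1) ≤ u1 * v2 - u2 * v1) : False := by
  obtain ⟨N, hN⟩ : ∃ N, c ^ 2 + d ^ 2 = N := ⟨_, rfl⟩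
  obtain ⟨x, hx⟩ : ∃ x, c * a1 + d * a2 = x := ⟨_, rfl⟩
  obtain ⟨k, hk⟩ : ∃ k, c * a2 - d * a1 = k := ⟨_, rfl⟩
  rw [hk] at hk0 hmin
  have hN0 : 0 < N := by
    rcases (by rw [← hN]; positivity : (0 : ℤ) ≤ N).lt_or_eq with h | h
    · exact h
    · exfalso
      have hc : c = 0 := by nlinarith
      have hd : d = 0 := by nlinarith
      rw [hc, hd] at hk; omega
  obtain ⟨h1, h2, h3', hx0, hx1, hd1⟩ := of_adm R c d m a1 a2 x k N hN hN0 hm hx hk hA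
  obtain ⟨-, -, h3, -, hx2, -⟩ := of_adm R c d m (a1 + j * c) (a2 + j * d) (x + j * N) k N hN hN0 hm
    (by rw [← hx, ← hN]; ring) (by rw [← hk]; ring) hB
  obtain ⟨xb, hxb⟩ : ∃ xb, xb = m * N - x - j * N := ⟨_, rfl⟩
  have hxb0 : 0 ≤ xb := by linarith
  have hxbR : (xb : ℝ) = m * N - x - j * N := by rw [hxb]; push_cast; ring
  have h3 : (N : ℝ) * R ≤ (xb : ℝ) ^ 2 + (k : ℝ) ^ 2 := by
    rw [hxbR]; push_cast at h3; nlinarith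
  have hs : x + xb ≤ (m - 1) * N := by nlinarith
  have hN1 : (1 : ℝ) ≤ N := by exact_mod_cast hN0
  have hm1 : (1 : ℝ) ≤ m := by exact_mod_cast hm
  have hL : ((m : ℝ) - 1) ^ 2 * N < R := by
    by_contra! h
    have hm2 : 0 < m - 1 := by
      by_contra! h'
      have : m = 1 := by omega
      rw [this] at h; norm_num at h; linarith
    have hge : (xb : ℝ) ≤ ((m : ℝ) - 1) * N - x := by
      have : xb ≤ (m - 1) * N - x := by linarith
      exact_mod_cast this
    have hxbR0 : (0 : ℝ) ≤ xb := by exact_mod_cast hxb0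
    have had := adm_of R c d (m - 1) a1 a2 x k N hN hN0 hm2.le hx hk (by push_cast; exact h) h2
      (by push_cast; nlinarith) hx0 (by linarith) (by nlinarith)
    have hdet : (m - 1) * c * a2 - (m - 1) * d * a1 = (m - 1) * k := by rw [← hk]; ring
    have := hmin _ _ _ _ had (by rw [hdet]; exact mul_pos hm2 hk0)
    rw [hdet] at this
    nlinarith
  obtain ⟨q, hq0, hqa, hq⟩ := basic R hR
  have hb : (m : ℝ) * k ≤ 0.88202 * R := by
    have e : 8 * q * (7 * q) - 0 * (4 * q) = 56 * q ^ 2 := by ring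
    have := hmin _ _ _ _ hqa (by rw [e]; positivity)
    rw [e] at this
    have : (m : ℝ) * k ≤ 56 * (q : ℝ) ^ 2 := by exact_mod_cast this
    linarith
  have hsR : (x : ℝ) + xb ≤ ((m : ℝ) - 1) * N := by exact_mod_cast hs
  obtain ⟨p1, p2, p3, p4, p5⟩ := prelim R m N k x xb hR hm1 hN1 (by exact_mod_cast hk0) h1 h2 h3
    (by exact_mod_cast hx0) (by exact_mod_cast hxb0) hsR hL hb
  rcases le_or_gt 3 N with h | h
  · exact main_big R hR c d N m k x xb a1 a2 hcd hN h hm hk0 hx hk h1 h2 h3 hx0 hxb0 hs p2 p3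
      (by exact_mod_cast p4) (by exact_mod_cast p5) hmin
  · exact main_small R hR c d N m k x xb a1 a2 j hN (by omega) hm hk0 hx hk h1 h2 h3 hx0 hxb0 hj hxb
      hL p1 p2 hmin

lemma main2 (R : ℝ) (hR : 4000000 ≤ R) (w1 w2 a1 a2 b1 b2 : ℤ)
    (hA : Adm R w1 w2 a1 a2) (hB : Adm R w1 w2 b1 b2) (hne : ¬ (a1 = b1 ∧ a2 = b2))
    (hpos : 0 < w1 * a2 - w2 * a1) (heq : w1 * a2 - w2 * a1 = w1 * b2 - w2 * b1)
    (hmin : ∀ u1 u2 v1 v2 : ℤ, Adm R u1 u2 v1 v2 → 0 < u1 * v2 - u2 * v1 →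
      w1 * a2 - w2 * a1 ≤ u1 * v2 - u2 * v1) : False := by
  have hg : 0 < Int.gcd w1 w2 := by
    rw [Int.gcd_pos_iff]
    by_contra! h
    rw [h.1, h.2] at hpos; simp at hpos
  obtain ⟨c, d, hcop, hc, hd⟩ := Int.exists_gcd_one hg
  obtain ⟨m, hm⟩ : ∃ m : ℤ, m = (Int.gcd w1 w2 : ℤ) := ⟨_, rfl⟩
  rw [← hm] at hc hd
  have hm0 : 0 < m := by omega
  clear hm hg
  have hcop : IsCoprime c d := Int.isCoprime_iff_gcd_eq_one.2 hcop
  rw [mul_comm] at hc hd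
  subst hc hd
  have hpar : c * (b2 - a2) = d * (b1 - a1) := by
    have : m * (c * (b2 - a2)) = m * (d * (b1 - a1)) := by linear_combination -heq
    exact mul_left_cancel₀ hm0.ne' this
  have hcop' := hcop
  obtain ⟨α, β, hαβ⟩ := hcop'
  obtain ⟨j, hj⟩ : ∃ j, j = α * (b1 - a1) + β * (b2 - a2) := ⟨_, rfl⟩
  have hj1 : b1 = a1 + j * c := by
    rw [hj]; linear_combination -(b1 - a1) * hαβ - β * hpar
  have hj2 : b2 = a2 + j * d := by
    rw [hj]; linear_combination -(b2 - a2) * hαβ + α * hpar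
  have hdet : m * c * a2 - m * d * a1 = m * (c * a2 - d * a1) := by ring
  rw [hdet] at hpos hmin
  have hk : 0 < c * a2 - d * a1 := (mul_pos_iff_of_pos_left hm0).1 hpos
  rcases lt_trichotomy j 0 with h | h | h
  · have e : c * b2 - d * b1 = c * a2 - d * a1 := by rw [hj1, hj2]; ring
    refine main_core R hR c d m (-j) b1 b2 hcop hm0 (by omega) hB ?_ (by rw [e]; exact hk)
      (by rw [e]; exact hmin)
    have e1 : b1 + -j * c = a1 := by rw [hj1]; ring
    have e2 : b2 + -j * d = a2 := by rw [hj2]; ring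
    rw [e1, e2]; exact hA
  · apply hne
    rw [h] at hj1 hj2
    constructor <;> linarith
  · exact main_core R hR c d m j a1 a2 hcop hm0 h hA (by rw [← hj1, ← hj2]; exact hB) hk hmin

lemma adm_reflect (R : ℝ) (u1 u2 v1 v2 : ℤ) (h : Adm R u1 u2 v1 v2) :
    Adm R u1 (-u2) v1 (-v2) := by
  obtain ⟨g1, g2, g3, g4, g5, g6⟩ := h
  refine ⟨?_, ?_, ?_, ?_, ?_, ?_⟩
  · rwa [neg_sq]
  · rwa [neg_sq]
  · have : -v2 - -u2 = -(v2 - u2) := by ring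
    rwa [this, neg_sq]
  all_goals linarith

lemma sq_side (D : ℝ) (hD : 0 < D) (n : ℤ) : D ≤ Real.sqrt (n : ℝ) ↔ D ^ 2 ≤ (n : ℝ) :=
  Real.le_sqrt' hD

lemma adm_of_inT (D : ℝ) (hD : 0 < D) (P Q T : ℤ × ℤ) (h : InT D P Q T) :
    Adm (D ^ 2) (Q.1 - P.1) (Q.2 - P.2) (T.1 - P.1) (T.2 - P.2) := by
  obtain ⟨-, h1, h2, h3, h4, h5, h6⟩ := h
  rw [sq_side D hD] at h1 h2 h3
  simp only [normSq2, dot2, sub2] at h1 h2 h3 h4 h5 h6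
  refine ⟨h1, ?_, ?_, h4, ?_, ?_⟩
  · refine h3.trans (le_of_eq ?_); push_cast; ring
  · refine h2.trans (le_of_eq ?_); push_cast; ring
  · linarith
  · linarith

lemma inT_of_adm (D : ℝ) (hD : 0 < D) (u1 u2 v1 v2 : ℤ) (h : Adm (D ^ 2) u1 u2 v1 v2)
    (h0 : u1 * v2 - u2 * v1 ≠ 0) : InT D (0, 0) (u1, u2) (v1, v2) := by
  obtain ⟨h1, h2, h3, h4, h5, h6⟩ := h
  refine ⟨?_, ?_, ?_, ?_, ?_, ?_, ?_⟩
  · simpa [det2, sub2] using h0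
  · rw [sq_side D hD]; simpa [normSq2, sub2] using h1
  · rw [sq_side D hD]; simpa [normSq2, sub2] using h3
  · rw [sq_side D hD]; simpa [normSq2, sub2] using h2
  · simpa [dot2, sub2] using h4
  · simp only [dot2, sub2]; linarith
  · simp only [dot2, sub2]; linarith

/-- For every real `D ≥ 2000`, sliding does not occur for `D`. -/
theorem no_sliding_above_2000 (D : ℝ) (hD : 2000 ≤ D) : ¬ Sliding D := by
  rintro ⟨O, W, A, B, ⟨hA, hAS⟩, ⟨hB, hBS⟩, hne, hside⟩
  have hD0 : 0 < D := by linarith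
  have hR : 4000000 ≤ D ^ 2 := by nlinarith
  have hA' := adm_of_inT D hD0 _ _ _ hA
  have hB' := adm_of_inT D hD0 _ _ _ hB
  have hmin : ∀ u1 u2 v1 v2 : ℤ, Adm (D ^ 2) u1 u2 v1 v2 → u1 * v2 - u2 * v1 ≠ 0 →
      S D ≤ (u1 * v2 - u2 * v1).natAbs := by
    intro u1 u2 v1 v2 h h0
    refine Nat.sInf_le ⟨(0, 0), (u1, u2), (v1, v2), inT_of_adm D hD0 _ _ _ _ h h0, ?_⟩
    simp [twiceArea, det2, sub2]
  simp only [twiceArea, det2, sub2] at hAS hBS hside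
  have hne' : ¬ (A.1 - O.1 = B.1 - O.1 ∧ A.2 - O.2 = B.2 - O.2) := by
    rintro ⟨e1, e2⟩
    exact hne (Prod.ext (by omega) (by omega))
  generalize W.1 - O.1 = w1 at *
  generalize W.2 - O.2 = w2 at *
  generalize A.1 - O.1 = a1 at *
  generalize A.2 - O.2 = a2 at *
  generalize B.1 - O.1 = b1 at *
  generalize B.2 - O.2 = b2 at *
  rcases pos_and_pos_or_neg_and_neg_of_mul_pos hside with ⟨e1, e2⟩ | ⟨e1, e2⟩
  · refine main2 _ hR w1 w2 a1 a2 b1 b2 hA' hB' hne' e1 (by omega) ?_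
    intro u1 u2 v1 v2 h h0
    have := hmin u1 u2 v1 v2 h (by omega)
    omega
  · refine main2 _ hR w1 (-w2) a1 (-a2) b1 (-b2) (adm_reflect _ _ _ _ _ hA')
      (adm_reflect _ _ _ _ _ hB') (by omega) (by linarith) ?_ ?_
    · have : w1 * a2 - w2 * a1 = w1 * b2 - w2 * b1 := by omega
      linarith
    · intro u1 u2 v1 v2 h h0
      have := hmin u1 u2 v1 v2 h (by omega)
      have e : w1 * -a2 - -w2 * a1 = -(w1 * a2 - w2 * a1) := by ring
      rw [e]; omega
end

section
/- Let ε = (3√3 − 5)/2. For every real number v and every closed interval J ⊂ ℝ of length at least 7, there exist an integer x ∈ J such that ‖√3·x + v‖ ≤ ε, and a half-integer y ∈ J (i.e., 2y ∈ ℤ) such that ‖√3·y + v‖ ≤ ε. -/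
/-- Distance from a real number to the nearest integer. -/
noncomputable def distNearestInt (x : ℝ) : ℝ := |x - round x|

/-- The distance to the nearest integer is at most the distance to any given integer. -/
lemma distNearestInt_le_of (x c : ℝ) (z : ℤ) (h1 : x - z ≤ c) (h2 : -c ≤ x - z) :
    distNearestInt x ≤ c :=
  (round_le x z).trans (abs_le.2 ⟨h2, h1⟩)

/-- Seven consecutive integers suffice. -/
lemma seven_consecutive (w : ℝ) : ∃ k : ℤ, 0 ≤ k ∧ k ≤ 6 ∧
    distNearestInt (Real.sqrt 3 * k + w) ≤ (3 * Real.sqrt 3 - 5) / 2 := by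
  have hs : Real.sqrt 3 * Real.sqrt 3 = 3 := Real.mul_self_sqrt (by norm_num)
  have hs0 : 0 ≤ Real.sqrt 3 := Real.sqrt_nonneg 3
  set s := Real.sqrt 3
  have hl : 1.732 ≤ s := by nlinarith
  have hu : s ≤ 1.7321 := by nlinarith
  have t0 := Int.floor_le w
  have t1 := Int.lt_floor_add_one w
  set N := ⌊w⌋
  have key : ∀ k z : ℤ, 0 ≤ k → k ≤ 6 → s * k + w - (z + N) ≤ (3 * s - 5) / 2 →
      -((3 * s - 5) / 2) ≤ s * k + w - (z + N) → ∃ k : ℤ, 0 ≤ k ∧ k ≤ 6 ∧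
      distNearestInt (s * k + w) ≤ (3 * s - 5) / 2 := by
    intro k z h0 h6 h1 h2
    exact ⟨k, h0, h6, distNearestInt_le_of _ _ (z + N) (by push_cast; exact h1)
      (by push_cast; exact h2)⟩
  set e := (3 * s - 5) / 2 with he
  by_cases c0 : w - N ≤ e
  · exact key 0 0 (by norm_num) (by norm_num) (by push_cast; linarith) (by push_cast; linarith)
  by_cases c4 : w - N ≤ 7 - 4 * s + e
  · exact key 4 7 (by norm_num) (by norm_num) (by push_cast; linarith) (by push_cast; linarith)
  by_cases c1 : w - N ≤ 2 - 1 * s + e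
  · exact key 1 2 (by norm_num) (by norm_num) (by push_cast; linarith) (by push_cast; linarith)
  by_cases c5 : w - N ≤ 9 - 5 * s + e
  · exact key 5 9 (by norm_num) (by norm_num) (by push_cast; linarith) (by push_cast; linarith)
  by_cases c2 : w - N ≤ 4 - 2 * s + e
  · exact key 2 4 (by norm_num) (by norm_num) (by push_cast; linarith) (by push_cast; linarith)
  by_cases c6 : w - N ≤ 11 - 6 * s + e
  · exact key 6 11 (by norm_num) (by norm_num) (by push_cast; linarith) (by push_cast; linarith)
  by_cases c3 : w - N ≤ 6 - 3 * s + e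
  · exact key 3 6 (by norm_num) (by norm_num) (by push_cast; linarith) (by push_cast; linarith)
  exact key 0 1 (by norm_num) (by norm_num) (by push_cast; linarith) (by push_cast; linarith)

/-- In any interval of length at least `7` one can find an integer `x` and a
half-integer `y` such that `√3·x + v` and `√3·y + v` are within
`ε = (3√3 − 5)/2` of an integer. -/
theorem approx_in_interval_seven (v a b : ℝ) (hab : 7 ≤ b - a) :
    (∃ x : ℤ, a ≤ (x : ℝ) ∧ (x : ℝ) ≤ b ∧
      distNearestInt (Real.sqrt 3 * x + v) ≤ (3 * Real.sqrt 3 - 5) / 2) ∧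
    (∃ y : ℝ, (∃ m : ℤ, 2 * y = (m : ℝ)) ∧ a ≤ y ∧ y ≤ b ∧
      distNearestInt (Real.sqrt 3 * y + v) ≤ (3 * Real.sqrt 3 - 5) / 2) := by
  obtain ⟨k, h0, h6, hk⟩ := seven_consecutive (Real.sqrt 3 * ⌈a⌉ + v)
  have h0' : (0 : ℝ) ≤ k := by exact_mod_cast h0
  have h6' : (k : ℝ) ≤ 6 := by exact_mod_cast h6
  have c1 := Int.le_ceil a
  have c2 := Int.ceil_lt_add_one a
  have hd : distNearestInt (Real.sqrt 3 * ((⌈a⌉ + k : ℤ) : ℝ) + v) ≤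
      (3 * Real.sqrt 3 - 5) / 2 := by
    convert hk using 2
    push_cast
    ring
  have ha : a ≤ ((⌈a⌉ + k : ℤ) : ℝ) := by push_cast; linarith
  have hb : ((⌈a⌉ + k : ℤ) : ℝ) ≤ b := by push_cast; linarith
  exact ⟨⟨⌈a⌉ + k, ha, hb, hd⟩,
    ⟨((⌈a⌉ + k : ℤ) : ℝ), ⟨2 * (⌈a⌉ + k), by push_cast; ring⟩, ha, hb, hd⟩⟩
end
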